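/- Let f : M → ℝ³ be an immersed surface endowed with a Birkhoff normal field η, and let p ∈ M be a point at which the two principal curvatures are distinct. If V₁, V₂ ∈ T_pM are principal directions associated with the two distinct principal curvatures, then h(V₁, V₂) = 0, where h is the affine fundamental form. -/

import Mathlib

/-!
Differential geometry of immersed surfaces in three-dimensional normed
(Minkowski) spaces, following Balestro–Martini–Teixeira.

`E3 = ℝ³` carries its standard Euclidean inner product and, in addition, a
norm `N` which is strictly convex and smooth.  Surfaces are given in a local
parametrization `f : P2 → E3` (an immersion on an open set `U`), endowed with
a Birkhoff normal field `η`.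
-/

noncomputable section

open scoped InnerProductSpace

abbrev E3 := EuclideanSpace ℝ (Fin 3)
abbrev P2 := EuclideanSpace ℝ (Fin 2)

/-- A smooth, strictly convex norm on `ℝ³` (a Minkowski norm). -/
structure MinkowskiNorm3 where
  N : E3 → ℝ
  nonneg : ∀ x, 0 ≤ N x
  eq_zero_iff : ∀ x, N x = 0 ↔ x = 0
  smul_eq : ∀ (c : ℝ) (x : E3), N (c • x) = |c| * N x
  triangle : ∀ x y, N (x + y) ≤ N x + N y
  strict_triangle : ∀ x y : E3, LinearIndependent ℝ ![x, y] → N (x + y) < N x + N y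
  smooth : ContDiffOn ℝ (⊤ : ℕ∞) N {x : E3 | x ≠ 0}

namespace MinkowskiNorm3

/-- Birkhoff orthogonality of a vector `v` to a set (e.g. a plane) `H`:
`‖v + w‖ ≥ ‖v‖` for all `w ∈ H`. -/
def BirkhoffOrth (m : MinkowskiNorm3) (v : E3) (H : Set E3) : Prop :=
  ∀ w ∈ H, m.N v ≤ m.N (v + w)

/-- The (outward) Euclidean Gauss map of the unit sphere `∂B` of the norm,
expressed on ambient space as the normalized gradient of `N`.  Restricted to
`∂B` it is the map `u⁻¹ : ∂B → ∂B_e`, whose inverse is `u : ∂B_e → ∂B`. -/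
def sphereGauss (m : MinkowskiNorm3) (v : E3) : E3 :=
  ‖gradient m.N v‖⁻¹ • gradient m.N v

/-- The differential `du⁻¹` at a point `v ∈ ∂B`, applied to a vector `w`
(its restriction to the tangent plane of `∂B` at `v` is the inverse of
`du_{u⁻¹(v)}`). -/
def duInv (m : MinkowskiNorm3) (v w : E3) : E3 :=
  fderiv ℝ m.sphereGauss v w

/-- Admissibility of the norm: the unit sphere `∂B` has positive Euclidean
Gaussian curvature at every point; equivalently, the second fundamental form
of `∂B` with respect to the outward normal is positive definite, i.e.
`⟪du⁻¹ w, w⟫ > 0` for every nonzero vector `w` tangent to `∂B`. -/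
def Admissible (m : MinkowskiNorm3) : Prop :=
  ∀ v : E3, m.N v = 1 → ∀ w : E3, w ≠ 0 → fderiv ℝ m.N v w = 0 →
    0 < ⟪m.duInv v w, w⟫_ℝ

end MinkowskiNorm3

/-- An immersed surface (in a local parametrization on an open set `U ⊆ ℝ²`)
in the Minkowski space `(ℝ³, m)`, endowed with a Birkhoff normal vector
field `η`: a smooth unit field with `η(p) ⊣_B T_pM` for all `p`. -/
structure BSurface (m : MinkowskiNorm3) where
  U : Set P2
  isOpen : IsOpen U
  f : P2 → E3
  smooth_f : ContDiffOn ℝ (⊤ : ℕ∞) f U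
  immersion : ∀ p ∈ U, Function.Injective (fderiv ℝ f p)
  η : P2 → E3
  smooth_η : ContDiffOn ℝ (⊤ : ℕ∞) η U
  unit_η : ∀ p ∈ U, m.N (η p) = 1
  birkhoff : ∀ p ∈ U, m.BirkhoffOrth (η p) (Set.range (fderiv ℝ f p))

namespace BSurface

variable {m : MinkowskiNorm3}

/-- The tangent plane `T_pM`, identified (via the push-forward `df_p`) with a
linear plane in ambient `ℝ³`. -/
def tangent (S : BSurface m) (p : P2) : Set E3 := Set.range (fderiv ℝ S.f p)

/-- `h : P2 → P2 → ℝ` (in the parameter coordinates, i.e. `h v w` stands for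
`h(df_p v, df_p w)`) is the affine fundamental form of the immersion at `p`,
determined by the Gauss formula `D_X Y = ∇_X Y + h(X,Y) η`: for coordinate
directions `v, w`, the second derivative `D_v D_w f` minus `h v w • η p` is
tangential. -/
def IsAffineFundForm (S : BSurface m) (p : P2) (h : P2 → P2 → ℝ) : Prop :=
  ∀ v w : P2,
    fderiv ℝ (fun q => fderiv ℝ S.f q w) p v - h v w • S.η p ∈ S.tangent p

end BSurface

/-- The Minkowski normal curvature of the surface parametrized by `f` with
Birkhoff normal field `η`, at `p`, in the tangent direction `X = df_p v`:
`k_{M,p}(X) = ⟪du⁻¹_{η(p)} X, dη_p X⟫ / ⟪du⁻¹_{η(p)} X, X⟫`, using the natural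
identification of the parallel planes `T_pM ≅ T_{η(p)}∂B ≅ T_{ξ(p)}∂B_e`. -/
def normalCurv (m : MinkowskiNorm3) (f η : P2 → E3) (p v : P2) : ℝ :=
  ⟪m.duInv (η p) (fderiv ℝ f p v), fderiv ℝ η p v⟫_ℝ /
    ⟪m.duInv (η p) (fderiv ℝ f p v), fderiv ℝ f p v⟫_ℝ

namespace MinkowskiNorm3

variable (m : MinkowskiNorm3) {v : E3}

theorem contDiffAt_N (hv : v ≠ 0) : ContDiffAt ℝ (⊤ : ℕ∞) m.N v :=
  m.smooth.contDiffAt (isOpen_ne.mem_nhds hv)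

theorem differentiableAt_N (hv : v ≠ 0) : DifferentiableAt ℝ m.N v :=
  (m.contDiffAt_N hv).differentiableAt (by simp)

theorem contDiffAt_fderiv_N (hv : v ≠ 0) : ContDiffAt ℝ 1 (fderiv ℝ m.N) v :=
  (m.contDiffAt_N hv).fderiv_right (by norm_cast)

theorem ne_zero_of_N_eq_one (hv : m.N v = 1) : v ≠ 0 := by
  rintro rfl
  simp [(m.eq_zero_iff 0).2 rfl] at hv

theorem hasDerivAt_N_line (hv : v ≠ 0) (w : E3) :
    HasDerivAt (fun t : ℝ => m.N (v + t • w)) (fderiv ℝ m.N v w) 0 := by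
  have h := (m.differentiableAt_N hv).hasFDerivAt.hasLineDerivAt w
  simpa [HasLineDerivAt] using h

/-- Euler's identity for the positively homogeneous function `N`. -/
theorem fderiv_N_self (hv : v ≠ 0) : fderiv ℝ m.N v v = m.N v := by
  have h₁ := m.hasDerivAt_N_line hv v
  have h₂ : HasDerivAt (fun t : ℝ => (1 + t) * m.N v) (m.N v) 0 := by
    simpa using ((hasDerivAt_id (0 : ℝ)).const_add 1).mul_const (m.N v)
  refine h₁.unique (h₂.congr_of_eventuallyEq ?_)
  filter_upwards [lt_mem_nhds (show (-1 : ℝ) < 0 by norm_num)] with t ht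
  rw [← abs_of_pos (show 0 < 1 + t by linarith), ← m.smul_eq, add_smul, one_smul]

theorem BirkhoffOrth.fderiv_N_eq_zero {m : MinkowskiNorm3} {L : P2 →L[ℝ] E3}
    (h : m.BirkhoffOrth v (Set.range L)) (hv : v ≠ 0) (w : P2) :
    fderiv ℝ m.N v (L w) = 0 := by
  refine IsLocalMin.hasDerivAt_eq_zero (Filter.Eventually.of_forall fun t => ?_)
    (m.hasDerivAt_N_line hv (L w))
  simpa using h (t • L w) ⟨t • w, by simp⟩

end MinkowskiNorm3

namespace BSurface

variable {m : MinkowskiNorm3} (S : BSurface m) {p : P2}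

theorem η_ne_zero (hp : p ∈ S.U) : S.η p ≠ 0 :=
  m.ne_zero_of_N_eq_one (S.unit_η p hp)

theorem contDiffAt_f (hp : p ∈ S.U) : ContDiffAt ℝ (⊤ : ℕ∞) S.f p :=
  S.smooth_f.contDiffAt (S.isOpen.mem_nhds hp)

theorem differentiableAt_η (hp : p ∈ S.U) : DifferentiableAt ℝ S.η p :=
  (S.smooth_η.contDiffAt (S.isOpen.mem_nhds hp)).differentiableAt (by simp)

theorem differentiableAt_fderiv_f (hp : p ∈ S.U) :
    DifferentiableAt ℝ (fderiv ℝ S.f) p :=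
  ((S.contDiffAt_f hp).fderiv_right (m := 1) (by norm_cast)).differentiableAt (by simp)

theorem fderiv_fderiv_f_apply (hp : p ∈ S.U) (v w : P2) :
    fderiv ℝ (fun q => fderiv ℝ S.f q w) p v = fderiv ℝ (fderiv ℝ S.f) p v w := by
  simp [fderiv_clm_apply (S.differentiableAt_fderiv_f hp) (differentiableAt_const w)]

theorem fderiv_fderiv_f_comm (hp : p ∈ S.U) (v w : P2) :
    fderiv ℝ (fderiv ℝ S.f) p v w = fderiv ℝ (fderiv ℝ S.f) p w v :=
  (S.contDiffAt_f hp).isSymmSndFDerivAt (by simp; norm_cast) v w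

/-- The differential of the norm at `η p` reads off the affine fundamental form. -/
theorem IsAffineFundForm.eq_fderiv_N {S : BSurface m} {h : P2 → P2 → ℝ}
    (hh : S.IsAffineFundForm p h) (hp : p ∈ S.U) (v w : P2) :
    h v w = fderiv ℝ m.N (S.η p) (fderiv ℝ (fderiv ℝ S.f) p v w) := by
  obtain ⟨u, hu⟩ := hh v w
  have h₀ := (S.birkhoff p hp).fderiv_N_eq_zero (S.η_ne_zero hp) u
  rw [hu, map_sub, map_smul, m.fderiv_N_self (S.η_ne_zero hp), S.unit_η p hp,
    S.fderiv_fderiv_f_apply hp, smul_eq_mul, mul_one, sub_eq_zero] at h₀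
  exact h₀.symm

/-- Weingarten-type formula: the affine fundamental form in terms of the Hessian of the norm. -/
theorem IsAffineFundForm.eq_neg_hessian {S : BSurface m} {h : P2 → P2 → ℝ}
    (hh : S.IsAffineFundForm p h) (hp : p ∈ S.U) (v w : P2) :
    h v w = -fderiv ℝ (fderiv ℝ m.N) (S.η p) (fderiv ℝ S.η p v) (fderiv ℝ S.f p w) := by
  have hG : DifferentiableAt ℝ (fderiv ℝ m.N) (S.η p) :=
    (m.contDiffAt_fderiv_N (S.η_ne_zero hp)).differentiableAt (by simp)
  have hGη := hG.hasFDerivAt.comp p (S.differentiableAt_η hp).hasFDerivAt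
  have hF := (S.differentiableAt_fderiv_f hp).hasFDerivAt.clm_apply (hasFDerivAt_const w p)
  have hzero : (fun q => fderiv ℝ m.N (S.η q) (fderiv ℝ S.f q w)) =ᶠ[nhds p] fun _ => 0 := by
    filter_upwards [S.isOpen.mem_nhds hp] with q hq
    exact (S.birkhoff q hq).fderiv_N_eq_zero (S.η_ne_zero hq) w
  have key := DFunLike.congr_fun ((hGη.clm_apply hF).unique
    ((hasFDerivAt_const (0 : ℝ) p).congr_of_eventuallyEq hzero)) v
  simp at key
  rw [hh.eq_fderiv_N hp]
  linarith

end BSurface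

/-- If the principal curvatures of `M` at `p` are distinct and
`V₁, V₂` are principal directions associated with them, then `h(V₁, V₂) = 0`. -/
theorem principal_directions_conjugate (m : MinkowskiNorm3) (S : BSurface m)
    (p : P2) (hp : p ∈ S.U) (h : P2 → P2 → ℝ)
    (hh : S.IsAffineFundForm p h)
    (lam₁ lam₂ : ℝ) (hne : lam₁ ≠ lam₂)
    (V₁ V₂ : P2) (hV₁ : V₁ ≠ 0) (hV₂ : V₂ ≠ 0)
    (e₁ : fderiv ℝ S.η p V₁ = lam₁ • fderiv ℝ S.f p V₁)
    (e₂ : fderiv ℝ S.η p V₂ = lam₂ • fderiv ℝ S.f p V₂) :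
    h V₁ V₂ = 0 := by
  have hN := ((m.contDiffAt_N (S.η_ne_zero hp)).isSymmSndFDerivAt (by simp; norm_cast)).eq
    (fderiv ℝ S.f p V₁) (fderiv ℝ S.f p V₂)
  have h₁₂ := hh.eq_neg_hessian hp V₁ V₂
  have h₂₁ := hh.eq_neg_hessian hp V₂ V₁
  have hsymm : h V₁ V₂ = h V₂ V₁ := by
    rw [hh.eq_fderiv_N hp, hh.eq_fderiv_N hp, S.fderiv_fderiv_f_comm hp]
  rw [e₁, map_smul, smul_apply, smul_eq_mul] at h₁₂
  rw [e₂, map_smul, smul_apply, smul_eq_mul, ← hN, ← hsymm] at h₂₁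
  set B := fderiv ℝ (fderiv ℝ m.N) (S.η p) (fderiv ℝ S.f p V₁) (fderiv ℝ S.f p V₂)
  have hB : B = 0 := by
    refine (mul_eq_zero.1 (?_ : (lam₁ - lam₂) * B = 0)).resolve_left (sub_ne_zero.2 hne)
    linarith
  rw [h₁₂, hB, mul_zero, neg_zero]
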